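/- Let n ≥ 2, w ∈ S_n, m ≥ 1, and suppose φ_1,...,φ_m, χ_1,...,χ_m ∈ S_n satisfy w ⪰ φ_1 ⪰ φ_2 ⪰ ... ⪰ φ_m ⪰ χ_1 ⪰ χ_2 ⪰ ... ⪰ χ_m in the Ehresmann order. Set l_k = φ_k(1) and M_k = χ_k(n), and assume the multiset {l_1,...,l_m} equals the multiset {M_1,...,M_m}. Then: (a) M_k = l_{m+1−k} for every k; and (b) every l_k is w-admissible, witnessed by the pair (φ_k, χ_{m+1−k}). (This is the combinatorial core of the paper's projective normality theorem: every torus-invariant standard monomial of shape m(ω_1+ω_{n−1}) on a Schubert variety X(w) factors as a product of m torus-invariant standard monomials of shape ω_1+ω_{n−1} on X(w).) -/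

import Mathlib

/-- `f` is (the one-line function of) a permutation of `{1,...,n}`. -/
def IsPermOn (n : ℕ) (f : ℕ → ℕ) : Prop :=
  Set.BijOn f (Set.Icc 1 n) (Set.Icc 1 n)

/-- `π_k(f)`: the increasing rearrangement of `(f 1, ..., f k)`, as a list. -/
def piSort (f : ℕ → ℕ) (k : ℕ) : List ℕ :=
  ((List.range' 1 k).map f).insertionSort (· ≤ ·)

/-- The Ehresmann (tableau) order: `u ⪯ w` iff `π_k(u) ≤ π_k(w)` entrywise for all `k`. -/
def Ehr (n : ℕ) (u w : ℕ → ℕ) : Prop :=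
  ∀ k, 1 ≤ k → k ≤ n → List.Forall₂ (· ≤ ·) (piSort u k) (piSort w k)

/-- `l` is `w`-admissible: there are permutations `χ ⪯ φ ⪯ w` with `φ(1) = l = χ(n)`. -/
def Admissible (n : ℕ) (w : ℕ → ℕ) (l : ℕ) : Prop :=
  ∃ φ χ : ℕ → ℕ, IsPermOn n φ ∧ IsPermOn n χ ∧
    Ehr n χ φ ∧ Ehr n φ w ∧ φ 1 = l ∧ χ n = l

theorem ehr_refl (n : ℕ) (u : ℕ → ℕ) : Ehr n u u := fun _ _ _ =>
  List.forall₂_same.2 fun _ _ => le_refl _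

theorem forall2_le_trans : ∀ {a b c : List ℕ}, List.Forall₂ (· ≤ ·) a b →
    List.Forall₂ (· ≤ ·) b c → List.Forall₂ (· ≤ ·) a c
  | _, _, _, .nil, .nil => .nil
  | _, _, _, .cons h t, .cons h' t' => .cons (le_trans h h') (forall2_le_trans t t')

theorem forall2_le_sum : ∀ {a b : List ℕ}, List.Forall₂ (· ≤ ·) a b → a.sum ≤ b.sum
  | _, _, .nil => le_refl _
  | _, _, .cons h t => by
    simp only [List.sum_cons]
    exact Nat.add_le_add h (forall2_le_sum t)

theorem ehr_trans {n : ℕ} {u v w : ℕ → ℕ} (h : Ehr n u v) (h' : Ehr n v w) : Ehr n u w :=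
  fun k h1 h2 => forall2_le_trans (h k h1 h2) (h' k h1 h2)

theorem ehr_first {n : ℕ} (hn : 2 ≤ n) {u w : ℕ → ℕ} (h : Ehr n u w) : u 1 ≤ w 1 := by
  have := h 1 le_rfl (by omega)
  simpa [piSort] using this

theorem piSort_sum (f : ℕ → ℕ) (k : ℕ) : (piSort f k).sum = ∑ i ∈ Finset.Icc 1 k, f i := by
  unfold piSort
  rw [(List.perm_insertionSort _ _).sum_eq]
  induction k with
  | zero => simp
  | succ k ih =>
    rw [List.range'_concat, Finset.sum_Icc_succ_top (by omega)]
    simp [ih, add_comm]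

theorem perm_sum {n : ℕ} {u : ℕ → ℕ} (hu : IsPermOn n u) :
    ∑ i ∈ Finset.Icc 1 n, u i = ∑ i ∈ Finset.Icc 1 n, i := by
  refine Finset.sum_bij (fun i _ => u i) ?_ ?_ ?_ ?_
  · intro i hi
    simpa using hu.mapsTo (by simpa using hi)
  · intro i hi j hj hij
    exact hu.injOn (by simpa using hi) (by simpa using hj) hij
  · intro b hb
    obtain ⟨a, ha, hab⟩ := hu.surjOn (show b ∈ Set.Icc 1 n by simpa using hb)
    exact ⟨a, by simpa using ha, hab⟩
  · intros
    rfl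

theorem ehr_last {n : ℕ} (hn : 2 ≤ n) {u w : ℕ → ℕ} (hu : IsPermOn n u) (hw : IsPermOn n w)
    (h : Ehr n u w) : w n ≤ u n := by
  obtain ⟨p, rfl⟩ : ∃ p, n = p + 1 := ⟨n - 1, by omega⟩
  have h1 := forall2_le_sum (h p (by omega) (by omega))
  rw [piSort_sum, piSort_sum] at h1
  have h2 := (perm_sum hu).trans (perm_sum hw).symm
  rw [Finset.sum_Icc_succ_top (by omega), Finset.sum_Icc_succ_top (by omega)] at h2
  omega

theorem chain_le {n m : ℕ} (φ : ℕ → ℕ → ℕ)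
    (h : ∀ k, 1 ≤ k → k < m → Ehr n (φ (k + 1)) (φ k)) (i j : ℕ) (hi : 1 ≤ i) (hij : i ≤ j)
    (hj : j ≤ m) : Ehr n (φ j) (φ i) := by
  induction j, hij using Nat.le_induction with
  | base => exact ehr_refl _ _
  | succ j hij ih => exact ehr_trans (h j (by omega) (by omega)) (ih (by omega))

theorem stmt11 (n m : ℕ) (hn : 2 ≤ n) (hm : 1 ≤ m)
    (w : ℕ → ℕ) (hw : IsPermOn n w)
    (φ χ : ℕ → ℕ → ℕ)
    (hperm : ∀ k, 1 ≤ k → k ≤ m → IsPermOn n (φ k) ∧ IsPermOn n (χ k))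
    (hchain1 : Ehr n (φ 1) w)
    (hchain2 : ∀ k, 1 ≤ k → k < m → Ehr n (φ (k + 1)) (φ k))
    (hchain3 : Ehr n (χ 1) (φ m))
    (hchain4 : ∀ k, 1 ≤ k → k < m → Ehr n (χ (k + 1)) (χ k))
    (hmulti : (((List.range' 1 m).map fun k => φ k 1 : List ℕ) : Multiset ℕ)
            = (((List.range' 1 m).map fun k => χ k n : List ℕ) : Multiset ℕ)) :
    (∀ k, 1 ≤ k → k ≤ m → χ k n = φ (m + 1 - k) 1) ∧
    (∀ k, 1 ≤ k → k ≤ m →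
      Ehr n (χ (m + 1 - k)) (φ k) ∧ Ehr n (φ k) w ∧ χ (m + 1 - k) n = φ k 1 ∧
      Admissible n w (φ k 1)) := by
  have key : ∀ k, 1 ≤ k → k ≤ m → χ k n = φ (m + 1 - k) 1 := by
    have hp : ((List.range' 1 m).map fun k => φ k 1).reverse.Perm
        ((List.range' 1 m).map fun k => χ k n) :=
      (List.reverse_perm _).trans (Multiset.coe_eq_coe.1 hmulti)
    have heq := hp.eq_of_pairwise (le := (· ≤ ·)) (fun a b _ _ h1 h2 => le_antisymm h1 h2)
      (by
        rw [List.pairwise_reverse, List.pairwise_iff_getElem]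
        intro i j hi hj hij
        simp only [List.length_map, List.length_range'] at hi hj
        simp only [List.getElem_map, List.getElem_range']
        exact ehr_first hn (chain_le φ hchain2 _ _ (by omega) (by omega) (by omega)))
      (by
        rw [List.pairwise_iff_getElem]
        intro i j hi hj hij
        simp only [List.length_map, List.length_range'] at hi hj
        simp only [List.getElem_map, List.getElem_range']
        exact ehr_last hn (hperm _ (by omega) (by omega)).2 (hperm _ (by omega) (by omega)).2
          (chain_le χ hchain4 _ _ (by omega) (by omega) (by omega)))
    intro k h1 h2
    have hk := congrArg (fun l => l[k - 1]?) heq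
    rw [List.getElem?_eq_getElem (by simp; omega), List.getElem?_eq_getElem (by simp; omega)] at hk
    simp only [List.getElem_reverse, List.getElem_map, List.getElem_range', List.length_map,
      List.length_range', Option.some.injEq] at hk
    rw [show 1 + 1 * (k - 1) = k by omega,
      show 1 + 1 * (m - 1 - (k - 1)) = m + 1 - k by omega] at hk
    exact hk.symm
  refine ⟨key, fun k h1 h2 => ?_⟩
  have a : Ehr n (χ (m + 1 - k)) (φ k) :=
    ehr_trans (chain_le χ hchain4 1 _ le_rfl (by omega) (by omega))
      (ehr_trans hchain3 (chain_le φ hchain2 k m h1 h2 le_rfl))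
  have b : Ehr n (φ k) w := ehr_trans (chain_le φ hchain2 1 k le_rfl h1 h2) hchain1
  have c : χ (m + 1 - k) n = φ k 1 := by
    rw [key _ (by omega) (by omega), show m + 1 - (m + 1 - k) = k by omega]
  exact ⟨a, b, c, φ k, χ (m + 1 - k), (hperm k h1 h2).1,
    (hperm _ (by omega) (by omega)).2, a, b, rfl, c⟩
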